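/- Let X be a random vector in ℝ^{d+1} with ‖X‖_{ψ2} ≤ M, let f be the clipped loss with parameters a, b, let h(x) = (x²−1)²/4, and for λ ≥ 0 and γ = (α, β) ∈ ℝ × ℝ^d define L_λ(γ) = E f(γ^⊤X) + (λ/2)α² and L^h_λ(γ) = E h(γ^⊤X) + (λ/2)α². There exist universal constants A, C₁, C₂ > 0 such that for all a ≥ A, b ≥ 2a and every R > 0: sup_{‖γ‖₂ ≤ R} ‖∇L_λ(γ) − ∇L^h_λ(γ)‖₂ ≤ C₂R³M⁴exp(−C₁a²/(R²M²)), and sup_{‖γ‖₂ ≤ R} ‖∇²L_λ(γ) − ∇²L^h_λ(γ)‖_{op} ≤ C₂R²M⁴exp(−C₁a²/(R²M²)). -/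

import Mathlib

open MeasureTheory ProbabilityTheory
open scoped RealInnerProductSpace

/-- `ℝ^d` with the Euclidean norm. -/
abbrev Vec (d : ℕ) := EuclideanSpace ℝ (Fin d)

/-- `ℝ × ℝ^d` with the Euclidean (ℓ²) norm; we identify `ℝ^{d+1}` with `ℝ × ℝ^d`,
`γ = (α, β)`. -/
abbrev Pr (d : ℕ) := WithLp 2 (ℝ × Vec d)

/-- The quartic loss `h(x) = (x² - 1)² / 4`. -/
noncomputable def hq (x : ℝ) : ℝ := (x ^ 2 - 1) ^ 2 / 4

/-- The clipped loss `f` with parameters `a < b`: it agrees with `hq` on `[-a, a]`,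
is a cubic spline on `a < |x| ≤ b` (built from `h'(a) = a³ - a` and `h''(a) = 3a² - 1`),
and is linear for `|x| > b`. -/
noncomputable def fclip (a b x : ℝ) : ℝ :=
  if |x| ≤ a then hq x
  else if |x| ≤ b then
    hq a + (a ^ 3 - a) * (|x| - a) + ((3 * a ^ 2 - 1) / 2) * (|x| - a) ^ 2
      - ((3 * a ^ 2 - 1) / (6 * (b - a))) * (|x| - a) ^ 3
  else
    (hq a + (a ^ 3 - a) * (b - a) + ((3 * a ^ 2 - 1) / 2) * (b - a) ^ 2
      - ((3 * a ^ 2 - 1) / (6 * (b - a))) * (b - a) ^ 3)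
      + ((a ^ 3 - a) + ((b - a) / 2) * (3 * a ^ 2 - 1)) * (|x| - b)

/-- The loss `L_λ(γ) = E g(γ⊤X) + (λ/2)α²` for `γ = (α, β) ∈ ℝ × ℝ^d ≅ ℝ^{d+1}`. -/
noncomputable def genLoss {d : ℕ} {Ω : Type*} [MeasurableSpace Ω] (P : Measure Ω)
    (X : Ω → Pr d) (g : ℝ → ℝ) (lam : ℝ) (γ : Pr d) : ℝ :=
  (∫ ω, g ⟪γ, X ω⟫ ∂P) + lam / 2 * ((WithLp.equiv 2 (ℝ × Vec d) γ).1) ^ 2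

noncomputable instance {d : ℕ} : MeasurableSpace (Pr d) := borel _
instance {d : ℕ} : BorelSpace (Pr d) := ⟨rfl⟩


theorem aux_tp (n : ℕ) (t : ℝ) :
    HasDerivAt (fun x : ℝ => max x 0 ^ (n + 2)) ((n + 2 : ℝ) * max t 0 ^ (n + 1)) t := by
  have hne : ∀ y : ℝ, y ≠ 0 →
      HasDerivAt (fun x : ℝ => max x 0 ^ (n + 2)) ((n + 2 : ℝ) * max y 0 ^ (n + 1)) y := by
    intro y hy
    rcases lt_or_gt_of_ne hy with h | h
    · have h1 : (fun x : ℝ => max x 0 ^ (n + 2)) =ᶠ[nhds y] fun _ => 0 := by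
        filter_upwards [Iio_mem_nhds h] with x hx
        rw [max_eq_right (le_of_lt hx)]; simp
      rw [max_eq_right h.le]
      simpa using (hasDerivAt_const y (0 : ℝ)).congr_of_eventuallyEq h1
    · have h1 : (fun x : ℝ => max x 0 ^ (n + 2)) =ᶠ[nhds y] fun x => x ^ (n + 2) := by
        filter_upwards [Ioi_mem_nhds h] with x hx
        rw [max_eq_left (le_of_lt hx)]
      rw [max_eq_left h.le]
      simpa using (hasDerivAt_pow (n + 2) y).congr_of_eventuallyEq h1
  by_cases ht : t = 0
  · subst ht
    refine hasDerivAt_of_hasDerivAt_of_ne (f := fun x : ℝ => max x 0 ^ (n + 2))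
      (g := fun y : ℝ => (n + 2 : ℝ) * max y 0 ^ (n + 1)) (x := 0) (fun y hy => hne y hy) ?_ ?_
    · exact Continuous.continuousAt (by fun_prop)
    · exact Continuous.continuousAt (by fun_prop)
  · exact hne t ht

noncomputable def auxP (k a b t : ℝ) : ℝ :=
  -(k + a) * max (t - a) 0 ^ 3 - max (t - a) 0 ^ 4 / 4 + k * max (t - b) 0 ^ 3
noncomputable def auxP1 (k a b t : ℝ) : ℝ :=
  -3 * (k + a) * max (t - a) 0 ^ 2 - max (t - a) 0 ^ 3 + 3 * k * max (t - b) 0 ^ 2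
noncomputable def auxP2 (k a b t : ℝ) : ℝ :=
  -6 * (k + a) * max (t - a) 0 - 3 * max (t - a) 0 ^ 2 + 6 * k * max (t - b) 0

theorem aux_tps (n : ℕ) (c t : ℝ) :
    HasDerivAt (fun x : ℝ => max (x - c) 0 ^ (n + 2)) ((n + 2 : ℝ) * max (t - c) 0 ^ (n + 1)) t := by
  have := (aux_tp n (t - c)).comp t ((hasDerivAt_id t).sub_const c)
  simpa [Function.comp_def] using this

theorem auxP_deriv (k a b t : ℝ) : HasDerivAt (auxP k a b) (auxP1 k a b t) t := by
  have h1 := (aux_tps 1 a t).const_mul (-(k + a))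
  have h2 := (aux_tps 2 a t).div_const 4
  have h3 := (aux_tps 1 b t).const_mul k
  have := (h1.sub h2).add h3
  refine HasDerivAt.congr_deriv (f := auxP k a b) this ?_
  unfold auxP1; norm_num; ring

theorem auxP1_deriv (k a b t : ℝ) : HasDerivAt (auxP1 k a b) (auxP2 k a b t) t := by
  have h1 := (aux_tps 0 a t).const_mul (-3 * (k + a))
  have h2 := (aux_tps 1 a t)
  have h3 := (aux_tps 0 b t).const_mul (3 * k)
  have := (h1.sub h2).add h3
  refine HasDerivAt.congr_deriv (f := auxP1 k a b) this ?_
  unfold auxP2; norm_num; ring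

theorem auxP2_cont (k a b : ℝ) : Continuous (auxP2 k a b) := by
  unfold auxP2; fun_prop

theorem auxP_zero {k a b t : ℝ} (hab : a ≤ b) (ht : t ≤ a) :
    auxP k a b t = 0 ∧ auxP1 k a b t = 0 ∧ auxP2 k a b t = 0 := by
  have h1 : max (t - a) 0 = 0 := max_eq_right (by linarith)
  have h2 : max (t - b) 0 = 0 := max_eq_right (by linarith)
  simp [auxP, auxP1, auxP2, h1, h2]

theorem auxP_bd {k a b t : ℝ} (ha : 1 ≤ a) (hab : a ≤ b) (hk : 0 ≤ k) (hka : k ≤ a / 2) (ht : a ≤ t) :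
    |auxP k a b t| ≤ 3 * t ^ 4 ∧ |auxP1 k a b t| ≤ 7 * t ^ 3 ∧ |auxP2 k a b t| ≤ 15 * t ^ 2 := by
  unfold auxP auxP1 auxP2
  have hu0 : 0 ≤ max (t - a) 0 := le_max_right _ _
  have hv0 : 0 ≤ max (t - b) 0 := le_max_right _ _
  have hu : max (t - a) 0 ≤ t := max_le (by linarith) (by linarith)
  have hv : max (t - b) 0 ≤ t := max_le (by linarith) (by linarith)
  generalize max (t - a) 0 = u at *
  generalize max (t - b) 0 = v at *
  have ht0 : 0 ≤ t := by linarith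
  have e1 : 0 ≤ k + a := by linarith
  have e2 : k + a ≤ 3 / 2 * t := by linarith
  have e3 : k ≤ t / 2 := by linarith
  have A2 : u ^ 2 ≤ t ^ 2 := by gcongr
  have A3 : u ^ 3 ≤ t ^ 3 := by gcongr
  have A4 : u ^ 4 ≤ t ^ 4 := by gcongr
  have B2 : v ^ 2 ≤ t ^ 2 := by gcongr
  have B3 : v ^ 3 ≤ t ^ 3 := by gcongr
  have c1 : (k + a) * u ≤ 3 / 2 * t * t := by gcongr
  have c2 : (k + a) * u ^ 2 ≤ 3 / 2 * t * t ^ 2 := by gcongr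
  have c3 : (k + a) * u ^ 3 ≤ 3 / 2 * t * t ^ 3 := by gcongr
  have d1 : k * v ≤ t / 2 * t := by gcongr
  have d2 : k * v ^ 2 ≤ t / 2 * t ^ 2 := by gcongr
  have d3 : k * v ^ 3 ≤ t / 2 * t ^ 3 := by gcongr
  have := mul_nonneg e1 hu0
  have := mul_nonneg e1 (pow_nonneg hu0 2)
  have := mul_nonneg e1 (pow_nonneg hu0 3)
  have := mul_nonneg hk hv0
  have := mul_nonneg hk (pow_nonneg hv0 2)
  have := mul_nonneg hk (pow_nonneg hv0 3)
  have := pow_nonneg hu0 2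
  have := pow_nonneg hu0 3
  have := pow_nonneg hu0 4
  have := pow_nonneg ht0 2
  have := pow_nonneg ht0 3
  have := pow_nonneg ht0 4
  refine ⟨?_, ?_, ?_⟩ <;> rw [abs_le] <;> constructor <;> nlinarith

noncomputable def auxk (a b : ℝ) : ℝ := (3 * a ^ 2 - 1) / (6 * (b - a))

theorem auxk_bd {a b : ℝ} (ha : 1 ≤ a) (hab : 2 * a ≤ b) : 0 ≤ auxk a b ∧ auxk a b ≤ a / 2 := by
  unfold auxk
  constructor
  · apply div_nonneg <;> nlinarith
  · rw [div_le_iff₀ (by linarith)]; nlinarith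

noncomputable def auxr (a b x : ℝ) : ℝ := auxP (auxk a b) a b x + auxP (auxk a b) a b (-x)
noncomputable def auxr1 (a b x : ℝ) : ℝ := auxP1 (auxk a b) a b x - auxP1 (auxk a b) a b (-x)
noncomputable def auxr2 (a b x : ℝ) : ℝ := auxP2 (auxk a b) a b x + auxP2 (auxk a b) a b (-x)

theorem auxr_deriv (a b x : ℝ) : HasDerivAt (auxr a b) (auxr1 a b x) x := by
  have h := (auxP_deriv (auxk a b) a b (-x)).comp x (hasDerivAt_neg x)
  have := (auxP_deriv (auxk a b) a b x).add h
  refine HasDerivAt.congr_deriv (f := auxr a b) this ?_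
  unfold auxr1; ring

theorem auxr1_deriv (a b x : ℝ) : HasDerivAt (auxr1 a b) (auxr2 a b x) x := by
  have h := (auxP1_deriv (auxk a b) a b (-x)).comp x (hasDerivAt_neg x)
  have := (auxP1_deriv (auxk a b) a b x).sub h
  refine HasDerivAt.congr_deriv (f := auxr1 a b) this ?_
  unfold auxr2; ring

theorem auxr2_cont (a b : ℝ) : Continuous (auxr2 a b) := by
  have := auxP2_cont (auxk a b) a b
  unfold auxr2; fun_prop

theorem auxr_zero {a b x : ℝ} (ha : 1 ≤ a) (hab : 2 * a ≤ b) (hx : |x| ≤ a) :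
    auxr a b x = 0 ∧ auxr1 a b x = 0 ∧ auxr2 a b x = 0 := by
  obtain ⟨h1, h2⟩ := abs_le.1 hx
  obtain ⟨p, q, r⟩ := auxP_zero (k := auxk a b) (a := a) (b := b) (t := x) (by linarith) h2
  obtain ⟨p', q', r'⟩ := auxP_zero (k := auxk a b) (a := a) (b := b) (t := -x) (by linarith)
    (by linarith)
  simp [auxr, auxr1, auxr2, *]

theorem auxr_bd {a b x : ℝ} (ha : 1 ≤ a) (hab : 2 * a ≤ b) :
    |auxr a b x| ≤ 3 * |x| ^ 4 ∧ |auxr1 a b x| ≤ 7 * |x| ^ 3 ∧ |auxr2 a b x| ≤ 15 * |x| ^ 2 := by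
  obtain ⟨hk, hka⟩ := auxk_bd ha hab
  rcases le_or_gt |x| a with hx | hx
  · obtain ⟨p, q, r⟩ := auxr_zero ha hab hx
    rw [p, q, r]; simp; positivity
  · have hb := auxP_bd (b := b) (t := |x|) ha (by linarith) hk hka hx.le
    have hz := auxP_zero (k := auxk a b) (a := a) (b := b) (t := -|x|) (by linarith)
      (by linarith)
    unfold auxr auxr1 auxr2
    rcases abs_cases x with ⟨h, _⟩ | ⟨h, _⟩
    · rw [h] at hz hb ⊢
      simpa [hz.1, hz.2.1, hz.2.2] using hb
    · rw [h] at hz hb ⊢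
      rw [neg_neg] at hz
      rw [hz.1, hz.2.1, hz.2.2, zero_add, zero_sub, zero_add, abs_neg]
      exact hb

theorem fclip_eq {a b : ℝ} (ha : 1 ≤ a) (hab : 2 * a ≤ b) (x : ℝ) :
    fclip a b x = hq x + auxr a b x := by
  have key : auxr a b x = auxP (auxk a b) a b |x| := by
    have hz := auxP_zero (k := auxk a b) (a := a) (b := b) (t := -|x|) (by linarith)
      (by have := abs_nonneg x; linarith)
    unfold auxr
    rcases abs_cases x with ⟨h, _⟩ | ⟨h, _⟩
    · rw [h] at hz ⊢; rw [hz.1]; ring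
    · rw [h] at hz ⊢
      rw [neg_neg] at hz
      rw [hz.1]; ring
  have hh : hq x = hq |x| := by simp [hq]
  rw [key, hh, fclip, ← hh, hh]
  generalize |x| = t
  have hba : b - a ≠ 0 := by intro h; linarith
  have hkk : 6 * auxk a b * (b - a) = 3 * a ^ 2 - 1 := by unfold auxk; field_simp
  change (if t ≤ a then _ else if t ≤ b then _ + _ + _ - auxk a b * _ else
    (_ + _ + _ - auxk a b * _) + _) = _
  generalize auxk a b = k at *
  split_ifs with h1 h2
  · rw [(auxP_zero (by linarith) h1).1]; ring
  · have e1 : max (t - a) 0 = t - a := max_eq_left (by linarith)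
    have e2 : max (t - b) 0 = 0 := max_eq_right (by linarith)
    unfold auxP hq; rw [e1, e2]; ring
  · have e1 : max (t - a) 0 = t - a := max_eq_left (by linarith)
    have e2 : max (t - b) 0 = t - b := max_eq_left (by linarith)
    unfold auxP hq; rw [e1, e2, ← hkk]
    have : a ^ 2 = (6 * k * (b - a) + 1) / 3 := by linarith
    linear_combination ((t - a) ^ 2 / 2) * hkk

section auxsec
variable {E : Type*} [NormedAddCommGroup E] [InnerProductSpace ℝ E] [FiniteDimensional ℝ E]
  {Ω : Type*} [MeasurableSpace Ω] {P : Measure Ω} [IsProbabilityMeasure P] {X : Ω → E}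

theorem aux_mom {M : ℝ} (hM : 0 < M)
    (Y : Ω → ℝ) (hY : AEStronglyMeasurable Y P)
    (h : ∀ p : ℝ, 1 ≤ p → Integrable (fun ω => |Y ω| ^ p) P ∧
            (∫ ω, |Y ω| ^ p ∂P) ^ (1 / p) ≤ Real.sqrt p * M) (k : ℕ) :
    Integrable (fun ω => ((Y ω / M) ^ 2 / 16) ^ k / (k.factorial : ℝ)) P ∧
      ∫ ω, ((Y ω / M) ^ 2 / 16) ^ k / (k.factorial : ℝ) ∂P ≤ (1 / 2) ^ k := by
  rcases Nat.eq_zero_or_pos k with rfl | hk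
  · simp
  have hk1 : (1 : ℝ) ≤ k := by exact_mod_cast hk
  have hp : (1 : ℝ) ≤ 2 * k := by linarith
  obtain ⟨hi, hb⟩ := h (2 * k) hp
  have e1 : ∀ ω, |Y ω| ^ (2 * k : ℝ) = (Y ω ^ 2) ^ k := by
    intro ω
    rw [← sq_abs, ← pow_mul, ← Real.rpow_natCast]; push_cast; rfl
  simp_rw [e1] at hi hb
  have e2 : ∀ ω, ((Y ω / M) ^ 2 / 16) ^ k / (k.factorial : ℝ) =
      (Y ω ^ 2) ^ k * (1 / ((16 * M ^ 2) ^ k * (k.factorial : ℝ))) := by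
    intro ω
    have : (Y ω / M) ^ 2 / 16 = Y ω ^ 2 / (16 * M ^ 2) := by field_simp
    rw [this, div_pow, div_div]; ring
  simp_rw [e2]
  refine ⟨hi.mul_const _, ?_⟩
  rw [integral_mul_const]
  have hI0 : 0 ≤ ∫ ω, (Y ω ^ 2) ^ k ∂P := integral_nonneg fun ω => by positivity
  have hI : ∫ ω, (Y ω ^ 2) ^ k ∂P ≤ (2 * k * M ^ 2) ^ k := by
    have := Real.rpow_le_rpow (z := 2 * k) (by positivity) hb (by linarith)
    rw [← Real.rpow_mul hI0, one_div_mul_cancel (by linarith), Real.rpow_one] at this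
    refine this.trans (le_of_eq ?_)
    have : (2 * k : ℝ) = ((2 * k : ℕ) : ℝ) := by push_cast; rfl
    rw [this, Real.rpow_natCast, pow_mul, mul_pow, Real.sq_sqrt (by positivity)]
  have hf : (k : ℝ) ^ k ≤ Real.exp k * k.factorial := by
    have := Real.pow_div_factorial_le_exp (k : ℝ) (by positivity) k
    rwa [div_le_iff₀ (by positivity)] at this
  have he : Real.exp k ≤ 4 ^ k := by
    have : Real.exp k = Real.exp 1 ^ k := by rw [← Real.exp_nat_mul]; simp
    rw [this]
    have := Real.exp_one_lt_d9
    have := Real.exp_pos 1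
    gcongr; linarith
  rw [mul_one_div, div_le_iff₀ (by positivity)]
  calc _ ≤ (2 * k * M ^ 2) ^ k := hI
    _ = (2 * M ^ 2) ^ k * (k : ℝ) ^ k := by rw [← mul_pow]; ring
    _ ≤ (2 * M ^ 2) ^ k * (4 ^ k * k.factorial) := by
        gcongr
        exact hf.trans (by gcongr)
    _ = _ := by
        rw [← mul_assoc, ← mul_assoc, ← mul_pow, ← mul_pow]; congr 2; ring

theorem aux_exp {M : ℝ} (hM : 0 < M)
    (Y : Ω → ℝ) (hY : AEStronglyMeasurable Y P)
    (h : ∀ p : ℝ, 1 ≤ p → Integrable (fun ω => |Y ω| ^ p) P ∧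
            (∫ ω, |Y ω| ^ p ∂P) ^ (1 / p) ≤ Real.sqrt p * M) :
    Integrable (fun ω => Real.exp ((Y ω / M) ^ 2 / 16)) P ∧
      ∫ ω, Real.exp ((Y ω / M) ^ 2 / 16) ∂P ≤ 2 := by
  have hm := aux_mom hM Y hY h
  have hmeas : AEStronglyMeasurable (fun ω => Real.exp ((Y ω / M) ^ 2 / 16)) P :=
    (by fun_prop : Continuous fun y : ℝ => Real.exp ((y / M) ^ 2 / 16)).comp_aestronglyMeasurable hY
  have hl : ∫⁻ ω, ENNReal.ofReal (Real.exp ((Y ω / M) ^ 2 / 16)) ∂P ≤ ENNReal.ofReal 2 := by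
    have e : ∀ ω, ENNReal.ofReal (Real.exp ((Y ω / M) ^ 2 / 16)) =
        ∑' k : ℕ, ENNReal.ofReal (((Y ω / M) ^ 2 / 16) ^ k / (k.factorial : ℝ)) := by
      intro ω
      rw [← ENNReal.ofReal_tsum_of_nonneg (fun k => by positivity)
        (Real.summable_pow_div_factorial _), Real.exp_eq_exp_ℝ,
        congrFun (NormedSpace.exp_eq_tsum_div (𝔸 := ℝ)) _]
    simp_rw [e]
    rw [lintegral_tsum (fun k => (hm k).1.aestronglyMeasurable.aemeasurable.ennreal_ofReal)]
    have hs := (hasSum_geometric_two)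
    rw [← hs.tsum_eq, ENNReal.ofReal_tsum_of_nonneg (fun k => by positivity) hs.summable]
    refine ENNReal.tsum_le_tsum fun k => ?_
    rw [← ofReal_integral_eq_lintegral_ofReal (hm k).1
      (Filter.Eventually.of_forall fun ω => by simp only [Pi.zero_apply]; positivity)]
    exact ENNReal.ofReal_le_ofReal (hm k).2
  constructor
  · refine ⟨hmeas, ?_⟩
    rw [hasFiniteIntegral_iff_ofReal (Filter.Eventually.of_forall fun ω => (Real.exp_pos _).le)]
    exact lt_of_le_of_lt hl ENNReal.ofReal_lt_top
  · rw [integral_eq_lintegral_of_nonneg_ae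
      (Filter.Eventually.of_forall fun ω => (Real.exp_pos _).le) hmeas]
    exact ENNReal.toReal_le_of_le_ofReal (by norm_num) hl

/-- sub-Gaussian hypothesis -/
def auxSG (P : Measure Ω) (X : Ω → E) (M : ℝ) : Prop :=
  ∀ u : E, ‖u‖ = 1 → ∀ p : ℝ, 1 ≤ p →
          Integrable (fun ω => |inner ℝ u (X ω)| ^ p) P ∧
            (∫ ω, |inner ℝ u (X ω)| ^ p ∂P) ^ (1 / p) ≤ Real.sqrt p * M

theorem aux_inner_meas (hX : AEStronglyMeasurable X P) (u : E) :
    AEStronglyMeasurable (fun ω => inner ℝ u (X ω)) P :=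
  (by fun_prop : Continuous fun y : E => inner ℝ u y).comp_aestronglyMeasurable hX

theorem aux_exp_le {M : ℝ} (hM : 0 < M) (hX : AEStronglyMeasurable X P) (h : auxSG P X M)
    (u : E) (hu : ‖u‖ ≤ 1) :
    Integrable (fun ω => Real.exp ((inner ℝ u (X ω) / M) ^ 2 / 16)) P ∧
      ∫ ω, Real.exp ((inner ℝ u (X ω) / M) ^ 2 / 16) ∂P ≤ 2 := by
  rcases eq_or_ne u 0 with rfl | hu0
  · simp
  have hn : 0 < ‖u‖ := norm_pos_iff.2 hu0
  set e : E := (‖u‖)⁻¹ • u with he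
  have hee : ‖e‖ = 1 := by rw [he, norm_smul]; simp [hn.ne']
  have hue : u = ‖u‖ • e := by rw [he, smul_smul, mul_inv_cancel₀ hn.ne', one_smul]
  obtain ⟨h1, h2⟩ := aux_exp hM _ (aux_inner_meas hX e) (h e hee)
  have hle : ∀ ω, Real.exp ((inner ℝ u (X ω) / M) ^ 2 / 16) ≤
      Real.exp ((inner ℝ e (X ω) / M) ^ 2 / 16) := by
    intro ω
    have : inner ℝ u (X ω) = ‖u‖ * inner ℝ e (X ω) := by
      conv_lhs => rw [hue]
      rw [real_inner_smul_left]
    rw [this]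
    apply Real.exp_le_exp.2
    have h3 : ‖u‖ ^ 2 ≤ 1 := pow_le_one₀ hn.le hu
    have h4 := sq_nonneg (inner ℝ e (X ω) / M)
    rw [mul_div_assoc, mul_pow]
    nlinarith
  have hi : Integrable (fun ω => Real.exp ((inner ℝ u (X ω) / M) ^ 2 / 16)) P := by
    refine h1.mono' ((by fun_prop : Continuous fun y : ℝ =>
      Real.exp ((y / M) ^ 2 / 16)).comp_aestronglyMeasurable (aux_inner_meas hX u)) ?_
    exact Filter.Eventually.of_forall fun ω => by
      rw [Real.norm_of_nonneg (Real.exp_pos _).le]; exact hle ω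
  exact ⟨hi, (integral_mono hi h1 hle).trans h2⟩

theorem aux_pt (y z w : ℝ) : y ^ 2 * |z| * |w| * Real.exp (y ^ 2 / 64) ≤
    2048 * (Real.exp (y ^ 2 / 16) + Real.exp (z ^ 2 / 16) + Real.exp (w ^ 2 / 16)) := by
  have e : ∀ t : ℝ, Real.exp (t ^ 2 / 16) = Real.exp (t ^ 2 / 64) ^ 4 := by
    intro t; rw [← Real.exp_nat_mul]; congr 1; push_cast; ring
  have l : ∀ t : ℝ, t ^ 2 ≤ 64 * Real.exp (t ^ 2 / 64) := by
    intro t; have := Real.add_one_le_exp (t ^ 2 / 64); linarith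
  have o : ∀ t : ℝ, 1 ≤ Real.exp (t ^ 2 / 64) := by
    intro t; apply Real.one_le_exp; positivity
  rw [e, e, e]
  have ly := l y
  have lz := l z
  have lw := l w
  have oy := o y
  have oz := o z
  have ow := o w
  generalize Real.exp (y ^ 2 / 64) = p at *
  generalize Real.exp (z ^ 2 / 64) = q at *
  generalize Real.exp (w ^ 2 / 64) = r at *
  have h1 : |z| * |w| ≤ 32 * (q + r) := by
    have := sq_nonneg (|z| - |w|)
    have := sq_abs z
    have := sq_abs w
    nlinarith
  have h2 : y ^ 2 * (|z| * |w|) ≤ (64 * p) * (32 * (q + r)) := by gcongr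
  have h3 : q ≤ q ^ 2 := by nlinarith
  have h4 : r ≤ r ^ 2 := by nlinarith
  calc y ^ 2 * |z| * |w| * p = y ^ 2 * (|z| * |w|) * p := by ring
    _ ≤ (64 * p) * (32 * (q + r)) * p := by gcongr
    _ = 2048 * (p ^ 2 * q + p ^ 2 * r) := by ring
    _ ≤ 2048 * (p ^ 2 * q ^ 2 + p ^ 2 * r ^ 2) := by gcongr
    _ ≤ _ := by nlinarith [sq_nonneg (p ^ 2 - q ^ 2), sq_nonneg (p ^ 2 - r ^ 2)]

/-- the key tail estimate -/
theorem aux_key {M R a : ℝ} (hM : 0 < M) (hR : 0 < R) (ha : 0 ≤ a)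
    (hX : AEStronglyMeasurable X P) (h : auxSG P X M)
    (γ u v : E) (hγ : ‖γ‖ ≤ R) (hu : ‖u‖ ≤ 1) (hv : ‖v‖ ≤ 1) (c : ℝ) (hc : 0 ≤ c) (F : Ω → ℝ)
    (hF0 : ∀ ω, |inner ℝ γ (X ω)| ≤ a → F ω = 0)
    (hF : ∀ ω, |F ω| ≤ c * (|inner ℝ γ (X ω)| ^ 2 * |inner ℝ u (X ω)| * |inner ℝ v (X ω)|)) :
    |∫ ω, F ω ∂P| ≤ c * 12288 * R ^ 2 * M ^ 4 * Real.exp (-(1 / 64) * a ^ 2 / (R ^ 2 * M ^ 2)) := by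
  have hγR : ‖(R⁻¹ • γ)‖ ≤ 1 := by
    rw [norm_smul, Real.norm_of_nonneg (by positivity), inv_mul_le_iff₀ hR]; linarith
  obtain ⟨i1, b1⟩ := aux_exp_le hM hX h _ hγR
  obtain ⟨i2, b2⟩ := aux_exp_le hM hX h u hu
  obtain ⟨i3, b3⟩ := aux_exp_le hM hX h v hv
  set T := Real.exp (-(1 / 64) * a ^ 2 / (R ^ 2 * M ^ 2)) with hT
  set B : Ω → ℝ := fun ω => (c * 2048 * R ^ 2 * M ^ 4 * T) *
    (Real.exp ((inner ℝ (R⁻¹ • γ) (X ω) / M) ^ 2 / 16) + Real.exp ((inner ℝ u (X ω) / M) ^ 2 / 16)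
      + Real.exp ((inner ℝ v (X ω) / M) ^ 2 / 16)) with hB
  have hBi : Integrable B P := ((i1.add i2).add i3).const_mul _
  have hFB : ∀ ω, ‖F ω‖ ≤ B ω := by
    intro ω
    rw [Real.norm_eq_abs]
    rcases le_or_gt |inner ℝ γ (X ω)| a with hle | hlt
    · rw [hF0 ω hle, abs_zero]; positivity
    · refine (hF ω).trans ?_
      have hpt := aux_pt (inner ℝ (R⁻¹ • γ) (X ω) / M) (inner ℝ u (X ω) / M) (inner ℝ v (X ω) / M)
      simp only [hB]
      rw [real_inner_smul_left] at hpt ⊢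
      generalize inner ℝ γ (X ω) = Y at *
      generalize inner ℝ u (X ω) = Z at *
      generalize inner ℝ v (X ω) = W at *
      have hY2 : a ^ 2 ≤ Y ^ 2 := by rw [← sq_abs Y]; gcongr
      have h1 : 1 ≤ T * Real.exp ((R⁻¹ * Y / M) ^ 2 / 64) := by
        rw [hT, ← Real.exp_add]
        apply Real.one_le_exp
        have : -(1 / 64) * a ^ 2 / (R ^ 2 * M ^ 2) + (R⁻¹ * Y / M) ^ 2 / 64 =
          (Y ^ 2 - a ^ 2) / (64 * (R ^ 2 * M ^ 2)) := by field_simp; ring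
        rw [this]
        apply div_nonneg (by linarith) (by positivity)
      have h2 : |Y| ^ 2 * |Z| * |W| = R ^ 2 * M ^ 4 * ((R⁻¹ * Y / M) ^ 2 * |Z / M| * |W / M|) := by
        rw [sq_abs, abs_div, abs_div, abs_of_pos hM]; field_simp
      rw [h2]
      have h0 : 0 ≤ (R⁻¹ * Y / M) ^ 2 * |Z / M| * |W / M| := by positivity
      generalize (R⁻¹ * Y / M) ^ 2 * |Z / M| * |W / M| = Q at *
      have hT0 : 0 ≤ T := (Real.exp_pos _).le
      calc c * (R ^ 2 * M ^ 4 * Q) ≤ c * (R ^ 2 * M ^ 4 *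
            (Q * (T * Real.exp ((R⁻¹ * Y / M) ^ 2 / 64)))) := by
              gcongr; exact le_mul_of_one_le_right h0 h1
        _ = c * R ^ 2 * M ^ 4 * T * (Q * Real.exp ((R⁻¹ * Y / M) ^ 2 / 64)) := by ring
        _ ≤ c * R ^ 2 * M ^ 4 * T * _ := mul_le_mul_of_nonneg_left hpt (by positivity)
        _ = _ := by ring
  have := norm_integral_le_of_norm_le hBi (Filter.Eventually.of_forall hFB)
  rw [Real.norm_eq_abs] at this
  refine this.trans ?_
  simp only [hB]
  rw [integral_const_mul, integral_add (by exact i1.add i2) i3, integral_add i1 i2]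
  have hT0 : 0 ≤ T := (Real.exp_pos _).le
  calc _ ≤ (c * 2048 * R ^ 2 * M ^ 4 * T) * (2 + 2 + 2) := by gcongr
    _ = _ := by ring

theorem aux_int4 {M : ℝ} (hX : AEStronglyMeasurable X P) (h : auxSG P X M) :
    Integrable (fun ω => (1 + ‖X ω‖) ^ 4) P := by
  have hmem : MemLp X 4 P := by
    let b := stdOrthonormalBasis ℝ E
    have e : X = fun ω => ∑ i, (inner ℝ (b i) (X ω)) • b i := by
      funext ω; exact (b.sum_repr' (X ω)).symm
    rw [e]
    refine memLp_finsetSum _ fun i _ => ?_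
    have h1 := (h (b i) (b.orthonormal.1 i) 4 (by norm_num)).1
    have : MemLp (fun ω => inner ℝ (b i) (X ω)) 4 P := by
      rw [← integrable_norm_rpow_iff (aux_inner_meas hX _) (by norm_num) (by norm_num)]
      simpa using h1
    have h2 := (ContinuousLinearMap.toSpanSingleton ℝ (b i)).comp_memLp' this
    simpa [Function.comp_def] using h2
  have h1 : MemLp (fun ω => 1 + ‖X ω‖) 4 P := (memLp_const (1 : ℝ)).add hmem.norm
  have h2 := MemLp.integrable_norm_pow (p := 4) (by exact_mod_cast h1) (by norm_num)
  refine h2.congr (Filter.Eventually.of_forall fun ω => ?_)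
  simp only [Real.norm_eq_abs]
  rw [abs_of_nonneg (by positivity)]

theorem aux_addgrad {f g : E → ℝ} {f' g' x : E} (hf : HasGradientAt f f' x)
    (hg : HasGradientAt g g' x) : HasGradientAt (fun y => f y + g y) (f' + g') x := by
  rw [hasGradientAt_iff_hasFDerivAt] at *
  rw [map_add]
  exact hf.add hg

structure auxReg (g g1 g2 : ℝ → ℝ) (K : ℝ) : Prop where
  d1 : ∀ x, HasDerivAt g (g1 x) x
  d2 : ∀ x, HasDerivAt g1 (g2 x) x
  c2 : Continuous g2
  b0 : ∀ x, |g x| ≤ K * (1 + |x|) ^ 4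
  b1 : ∀ x, |g1 x| ≤ K * (1 + |x|) ^ 3
  b2 : ∀ x, |g2 x| ≤ K * (1 + |x|) ^ 2

theorem auxReg.K0 {g g1 g2 : ℝ → ℝ} {K : ℝ} (h : auxReg g g1 g2 K) : 0 ≤ K := by
  have := (abs_nonneg _).trans (h.b0 0)
  simpa using this

theorem auxReg.cg {g g1 g2 : ℝ → ℝ} {K : ℝ} (h : auxReg g g1 g2 K) : Continuous g :=
  continuous_iff_continuousAt.2 fun x => (h.d1 x).continuousAt
theorem auxReg.cg1 {g g1 g2 : ℝ → ℝ} {K : ℝ} (h : auxReg g g1 g2 K) : Continuous g1 :=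
  continuous_iff_continuousAt.2 fun x => (h.d2 x).continuousAt

theorem aux_inner_bd {r : ℝ} (γ x : E) (hγ : ‖γ‖ ≤ r) :
    1 + |inner ℝ γ x| ≤ (1 + r) * (1 + ‖x‖) := by
  have h1 := abs_real_inner_le_norm γ x
  have h2 : ‖γ‖ * ‖x‖ ≤ r * ‖x‖ := by gcongr
  have := norm_nonneg x
  have := (norm_nonneg γ).trans hγ
  nlinarith

theorem aux_bds {g g1 g2 : ℝ → ℝ} {K r : ℝ} (h : auxReg g g1 g2 K) (γ x : E) (hγ : ‖γ‖ ≤ r) :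
    |g (inner ℝ γ x)| ≤ K * (1 + r) ^ 4 * (1 + ‖x‖) ^ 4 ∧
    |g1 (inner ℝ γ x)| * ‖x‖ ≤ K * (1 + r) ^ 3 * (1 + ‖x‖) ^ 4 ∧
    |g2 (inner ℝ γ x)| * (‖x‖ * ‖x‖) ≤ K * (1 + r) ^ 2 * (1 + ‖x‖) ^ 4 := by
  have hK := h.K0
  have hb := aux_inner_bd γ x hγ
  have hx := norm_nonneg x
  have hr := (norm_nonneg γ).trans hγ
  have hx1 : ‖x‖ ≤ 1 + ‖x‖ := by linarith
  refine ⟨?_, ?_, ?_⟩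
  · calc _ ≤ K * (1 + |inner ℝ γ x|) ^ 4 := h.b0 _
      _ ≤ K * ((1 + r) * (1 + ‖x‖)) ^ 4 := by gcongr
      _ = _ := by ring
  · calc _ ≤ K * (1 + |inner ℝ γ x|) ^ 3 * ‖x‖ := by gcongr; exact h.b1 _
      _ ≤ K * ((1 + r) * (1 + ‖x‖)) ^ 3 * (1 + ‖x‖) := by gcongr
      _ = _ := by ring
  · calc _ ≤ K * (1 + |inner ℝ γ x|) ^ 2 * (‖x‖ * ‖x‖) := by gcongr; exact h.b2 _
      _ ≤ K * ((1 + r) * (1 + ‖x‖)) ^ 2 * ((1 + ‖x‖) * (1 + ‖x‖)) := by gcongr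
      _ = _ := by ring

theorem aux_innerd (γ x : E) : HasFDerivAt (fun γ : E => inner ℝ γ x) (innerSL ℝ x) γ := by
  have : (fun γ : E => inner ℝ γ x) = fun γ => innerSL ℝ x γ := by
    funext γ; rw [innerSL_apply_apply, real_inner_comm]
  rw [this]
  exact (innerSL ℝ x).hasFDerivAt

theorem aux_int0 {g g1 g2 : ℝ → ℝ} {K : ℝ} (h : auxReg g g1 g2 K)
    (hX : AEStronglyMeasurable X P) (hi : Integrable (fun ω => (1 + ‖X ω‖) ^ 4) P) (γ : E) :
    Integrable (fun ω => g (inner ℝ γ (X ω))) P := by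
  have hc := h.cg
  refine (hi.const_mul (K * (1 + ‖γ‖) ^ 4)).mono' ((by fun_prop : Continuous fun x : E =>
    g (inner ℝ γ x)).comp_aestronglyMeasurable hX) (Filter.Eventually.of_forall fun ω => ?_)
  exact (aux_bds h γ (X ω) le_rfl).1

theorem aux_int1 {g g1 g2 : ℝ → ℝ} {K : ℝ} (h : auxReg g g1 g2 K)
    (hX : AEStronglyMeasurable X P) (hi : Integrable (fun ω => (1 + ‖X ω‖) ^ 4) P) (γ : E) :
    Integrable (fun ω => g1 (inner ℝ γ (X ω)) • X ω) P := by
  have hc := h.cg1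
  refine (hi.const_mul (K * (1 + ‖γ‖) ^ 3)).mono' ((by fun_prop : Continuous fun x : E =>
    g1 (inner ℝ γ x) • x).comp_aestronglyMeasurable hX) (Filter.Eventually.of_forall fun ω => ?_)
  rw [norm_smul]
  exact (aux_bds h γ (X ω) le_rfl).2.1

noncomputable def auxT (g2 : ℝ → ℝ) (γ x : E) : E →L[ℝ] E :=
  (innerSL ℝ x).smulRight (g2 (inner ℝ γ x) • x)

theorem auxT_cont {g2 : ℝ → ℝ} (hc : Continuous g2) (γ : E) :
    Continuous fun x : E => auxT g2 γ x := by
  have : (fun x : E => auxT g2 γ x) = fun x : E =>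
    ContinuousLinearMap.smulRightL ℝ E E (innerSL ℝ x) (g2 (inner ℝ γ x) • x) := by
    funext x; ext v; simp [auxT, smul_smul, mul_comm]
  rw [this]
  fun_prop

theorem auxT_norm (g2 : ℝ → ℝ) (γ x : E) : ‖auxT g2 γ x‖ = |g2 (inner ℝ γ x)| * (‖x‖ * ‖x‖) := by
  rw [auxT, ContinuousLinearMap.norm_smulRight_apply, innerSL_apply_norm, norm_smul,
    Real.norm_eq_abs]; ring

theorem aux_int2 {g g1 g2 : ℝ → ℝ} {K : ℝ} (h : auxReg g g1 g2 K)
    (hX : AEStronglyMeasurable X P) (hi : Integrable (fun ω => (1 + ‖X ω‖) ^ 4) P) (γ : E) :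
    Integrable (fun ω => auxT g2 γ (X ω)) P := by
  refine (hi.const_mul (K * (1 + ‖γ‖) ^ 2)).mono'
    ((auxT_cont h.c2 γ).comp_aestronglyMeasurable hX) (Filter.Eventually.of_forall fun ω => ?_)
  rw [auxT_norm]
  exact (aux_bds h γ (X ω) le_rfl).2.2

theorem aux_ball {γ γ' : E} (h : γ' ∈ Metric.ball γ 1) : ‖γ'‖ ≤ ‖γ‖ + 1 := by
  have := norm_le_norm_add_norm_sub γ γ'
  rw [Metric.mem_ball, dist_eq_norm, norm_sub_rev] at h
  linarith

theorem aux_grad {g g1 g2 : ℝ → ℝ} {K : ℝ} (h : auxReg g g1 g2 K)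
    (hX : AEStronglyMeasurable X P) (hi : Integrable (fun ω => (1 + ‖X ω‖) ^ 4) P) (γ : E) :
    HasGradientAt (fun γ => ∫ ω, g (inner ℝ γ (X ω)) ∂P)
      (∫ ω, g1 (inner ℝ γ (X ω)) • X ω ∂P) γ := by
  have hc := h.cg
  have hc1 := h.cg1
  have hm : AEStronglyMeasurable (fun ω => g1 (inner ℝ γ (X ω)) • innerSL ℝ (X ω)) P :=
    (by fun_prop : Continuous fun x : E =>
      g1 (inner ℝ γ x) • innerSL ℝ x).comp_aestronglyMeasurable hX
  have key := hasFDerivAt_integral_of_dominated_of_fderiv_le (𝕜 := ℝ) (μ := P)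
    (F := fun (γ : E) ω => g (inner ℝ γ (X ω)))
    (F' := fun (γ : E) ω => g1 (inner ℝ γ (X ω)) • innerSL ℝ (X ω)) (x₀ := γ)
    (bound := fun ω => K * (1 + (‖γ‖ + 1)) ^ 3 * (1 + ‖X ω‖) ^ 4)
    (Metric.ball_mem_nhds γ one_pos)
    (Filter.Eventually.of_forall fun γ' => (aux_int0 h hX hi γ').aestronglyMeasurable)
    (aux_int0 h hX hi γ) hm
    (Filter.Eventually.of_forall fun ω γ' hγ' => by
      rw [norm_smul, innerSL_apply_norm]
      exact (aux_bds h γ' (X ω) (aux_ball hγ')).2.1)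
    (hi.const_mul _)
    (Filter.Eventually.of_forall fun ω γ' _ => (h.d1 _).comp_hasFDerivAt γ' (aux_innerd γ' (X ω)))
  rw [hasGradientAt_iff_hasFDerivAt]
  refine key.congr_fderiv ?_
  have hI : Integrable (fun ω => g1 (inner ℝ γ (X ω)) • innerSL ℝ (X ω)) P := by
    refine (aux_int1 h hX hi γ).norm.mono' hm (Filter.Eventually.of_forall fun ω => ?_)
    rw [norm_smul, norm_smul, innerSL_apply_norm]
  ext v
  rw [ContinuousLinearMap.integral_apply hI, InnerProductSpace.toDual_apply_apply,
    real_inner_comm, ← integral_inner (aux_int1 h hX hi γ)]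
  refine integral_congr_ae (Filter.Eventually.of_forall fun ω => ?_)
  simp only [smul_apply, innerSL_apply_apply, real_inner_smul_right,
    smul_eq_mul]
  rw [real_inner_comm v]

theorem aux_hess {g g1 g2 : ℝ → ℝ} {K : ℝ} (h : auxReg g g1 g2 K)
    (hX : AEStronglyMeasurable X P) (hi : Integrable (fun ω => (1 + ‖X ω‖) ^ 4) P) (γ : E) :
    HasFDerivAt (fun γ => ∫ ω, g1 (inner ℝ γ (X ω)) • X ω ∂P)
      (∫ ω, auxT g2 γ (X ω) ∂P) γ := by
  refine hasFDerivAt_integral_of_dominated_of_fderiv_le (𝕜 := ℝ) (μ := P)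
    (F := fun (γ : E) ω => g1 (inner ℝ γ (X ω)) • X ω)
    (F' := fun (γ : E) ω => auxT g2 γ (X ω)) (x₀ := γ)
    (bound := fun ω => K * (1 + (‖γ‖ + 1)) ^ 2 * (1 + ‖X ω‖) ^ 4)
    (Metric.ball_mem_nhds γ one_pos)
    (Filter.Eventually.of_forall fun γ' => (aux_int1 h hX hi γ').aestronglyMeasurable)
    (aux_int1 h hX hi γ) (aux_int2 h hX hi γ).aestronglyMeasurable
    (Filter.Eventually.of_forall fun ω γ' hγ' => by
      rw [auxT_norm]
      exact (aux_bds h γ' (X ω) (aux_ball hγ')).2.2)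
    (hi.const_mul _)
    (Filter.Eventually.of_forall fun ω γ' _ => ?_)
  have := ((h.d2 _).comp_hasFDerivAt γ' (aux_innerd γ' (X ω))).smul_const (X ω)
  refine HasFDerivAt.congr_fderiv (f := fun γ : E => g1 (inner ℝ γ (X ω)) • X ω) this ?_
  ext v
  simp [auxT, smul_smul, mul_comm]

theorem auxr_reg {a b : ℝ} (ha : 1 ≤ a) (hab : 2 * a ≤ b) :
    auxReg (auxr a b) (auxr1 a b) (auxr2 a b) 15 where
  d1 := auxr_deriv a b
  d2 := auxr1_deriv a b
  c2 := auxr2_cont a b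
  b0 x := by
    refine (auxr_bd ha hab).1.trans ?_
    have : |x| ≤ 1 + |x| := by linarith
    gcongr
    norm_num
  b1 x := by
    refine (auxr_bd ha hab).2.1.trans ?_
    have : |x| ≤ 1 + |x| := by linarith
    gcongr
    norm_num
  b2 x := by
    refine (auxr_bd ha hab).2.2.trans ?_
    have : |x| ≤ 1 + |x| := by linarith
    gcongr

theorem auxh_reg : auxReg hq (fun x => x ^ 3 - x) (fun x => 3 * x ^ 2 - 1) 3 where
  d1 x := by
    have := (((hasDerivAt_pow 2 x).sub_const 1).pow 2).div_const 4
    refine HasDerivAt.congr_deriv (f := hq) this ?_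
    simp; ring
  d2 x := by
    have := (hasDerivAt_pow 3 x).sub (hasDerivAt_id x)
    refine HasDerivAt.congr_deriv (f := fun x : ℝ => x ^ 3 - x) this ?_
    norm_num
  c2 := by fun_prop
  b0 x := by
    unfold hq
    rw [abs_of_nonneg (by positivity), ← sq_abs x]
    have := abs_nonneg x
    generalize |x| = t at *
    have : 0 ≤ t ^ 2 := by positivity
    have : 0 ≤ t ^ 3 := by positivity
    have : 0 ≤ t ^ 4 := by positivity
    nlinarith
  b1 x := by
    have h1 : |x ^ 3 - x| ≤ |x| ^ 3 + |x| := by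
      refine (abs_sub _ _).trans ?_; rw [abs_pow]
    refine h1.trans ?_
    have := abs_nonneg x
    generalize |x| = t at *
    have : 0 ≤ t ^ 2 := by positivity
    have : 0 ≤ t ^ 3 := by positivity
    nlinarith
  b2 x := by
    rw [← sq_abs x]
    have := abs_nonneg x
    generalize |x| = t at *
    rw [abs_le]; constructor <;> nlinarith

theorem aux_rgrad {M R a b : ℝ} (hM : 0 < M) (hR : 0 < R) (ha : 1 ≤ a) (hab : 2 * a ≤ b)
    (hX : AEStronglyMeasurable X P) (h : auxSG P X M) (γ : E) (hγ : ‖γ‖ ≤ R) :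
    ‖∫ ω, auxr1 a b (inner ℝ γ (X ω)) • X ω ∂P‖ ≤
      184320 * R ^ 3 * M ^ 4 * Real.exp (-(1 / 64) * a ^ 2 / (R ^ 2 * M ^ 2)) := by
  have hi := aux_int4 hX h
  have hreg := auxr_reg ha hab
  set V := ∫ ω, auxr1 a b (inner ℝ γ (X ω)) • X ω ∂P with hV
  rcases eq_or_ne V 0 with h0 | h0
  · rw [h0, norm_zero]; positivity
  have hn : 0 < ‖V‖ := norm_pos_iff.2 h0
  set u : E := (‖V‖)⁻¹ • V with hu
  have hu1 : ‖u‖ = 1 := by rw [hu, norm_smul]; simp [hn.ne']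
  have hVu : ‖V‖ = inner ℝ u V := by
    rw [hu, real_inner_smul_left, real_inner_self_eq_norm_sq]; field_simp
  have hγR : ‖(R⁻¹ • γ)‖ ≤ 1 := by
    rw [norm_smul, Real.norm_of_nonneg (by positivity), inv_mul_le_iff₀ hR]; linarith
  rw [hVu]
  conv_lhs => rw [hV]
  rw [← integral_inner (aux_int1 hreg hX hi γ)]
  refine (le_abs_self _).trans ?_
  refine (aux_key (a := a) hM hR (by linarith) hX h γ u (R⁻¹ • γ) hγ hu1.le hγR (7 * R)
    (by positivity) _ ?_ ?_).trans ?_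
  · intro ω hω
    simp [(auxr_zero ha hab hω).2.1]
  · intro ω
    simp only [real_inner_smul_right, real_inner_smul_left]
    rw [abs_mul, abs_mul, abs_inv, abs_of_pos hR]
    have := (auxr_bd (x := inner ℝ γ (X ω)) ha hab).2.1
    calc _ ≤ 7 * |inner ℝ γ (X ω)| ^ 3 * |inner ℝ u (X ω)| := by gcongr
      _ = _ := by field_simp
  · have := Real.exp_pos (-(1 / 64) * a ^ 2 / (R ^ 2 * M ^ 2))
    generalize Real.exp (-(1 / 64) * a ^ 2 / (R ^ 2 * M ^ 2)) = T at *
    have : 0 ≤ R ^ 3 * M ^ 4 * T := by positivity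
    nlinarith

theorem aux_rhess {M R a b : ℝ} (hM : 0 < M) (hR : 0 < R) (ha : 1 ≤ a) (hab : 2 * a ≤ b)
    (hX : AEStronglyMeasurable X P) (h : auxSG P X M) (γ : E) (hγ : ‖γ‖ ≤ R) :
    ‖∫ ω, auxT (auxr2 a b) γ (X ω) ∂P‖ ≤
      184320 * R ^ 2 * M ^ 4 * Real.exp (-(1 / 64) * a ^ 2 / (R ^ 2 * M ^ 2)) := by
  have hi := aux_int4 hX h
  have hreg := auxr_reg ha hab
  have hI := aux_int2 hreg hX hi γ
  refine ContinuousLinearMap.opNorm_le_of_unit_norm (by positivity) fun v hv => ?_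
  rw [ContinuousLinearMap.integral_apply hI]
  have hIv : Integrable (fun ω => auxT (auxr2 a b) γ (X ω) v) P := hI.apply_continuousLinearMap v
  set V := ∫ ω, auxT (auxr2 a b) γ (X ω) v ∂P with hV
  rcases eq_or_ne V 0 with h0 | h0
  · rw [h0, norm_zero]; positivity
  have hn : 0 < ‖V‖ := norm_pos_iff.2 h0
  set u : E := (‖V‖)⁻¹ • V with hu
  have hu1 : ‖u‖ = 1 := by rw [hu, norm_smul]; simp [hn.ne']
  have hVu : ‖V‖ = inner ℝ u V := by
    rw [hu, real_inner_smul_left, real_inner_self_eq_norm_sq]; field_simp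
  rw [hVu]
  conv_lhs => rw [hV]
  rw [← integral_inner hIv]
  refine (le_abs_self _).trans ?_
  refine (aux_key (a := a) hM hR (by linarith) hX h γ u v hγ hu1.le hv.le 15
    (by positivity) _ ?_ ?_).trans ?_
  · intro ω hω
    simp [auxT, (auxr_zero ha hab hω).2.2]
  · intro ω
    simp only [auxT, ContinuousLinearMap.smulRight_apply, innerSL_apply_apply,
      real_inner_smul_right]
    rw [abs_mul, abs_mul, real_inner_comm v]
    have := (auxr_bd (x := inner ℝ γ (X ω)) ha hab).2.2
    calc _ ≤ |inner ℝ v (X ω)| * (15 * |inner ℝ γ (X ω)| ^ 2 * |inner ℝ u (X ω)|) := by gcongr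
      _ = _ := by ring
  · apply le_of_eq; ring

end auxsec

/-- there are universal constants `A, C₁, C₂ > 0` such that for every random
vector `X` in `ℝ^{d+1}` with `‖X‖_{ψ₂} ≤ M`, all `a ≥ A`, `b ≥ 2a`, `λ ≥ 0` and `R > 0`, the
gradient and Hessian of the clipped loss `L_λ` and of the quartic loss `L^h_λ` differ on the
ball of radius `R` by at most `C₂R³M⁴exp(−C₁a²/(R²M²))` and `C₂R²M⁴exp(−C₁a²/(R²M²))`
respectively. -/
theorem clipped_vs_quartic_population_loss_perturbation :
    ∃ A C₁ C₂ : ℝ, 0 < A ∧ 0 < C₁ ∧ 0 < C₂ ∧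
      ∀ (d : ℕ) (Ω : Type) [MeasurableSpace Ω] (P : Measure Ω) [IsProbabilityMeasure P]
        (X : Ω → Pr d) (M lam a b R : ℝ),
        0 < M → A ≤ a → 2 * a ≤ b → 0 ≤ lam → 0 < R →
        Measurable X →
        (∀ u : Pr d, ‖u‖ = 1 → ∀ p : ℝ, 1 ≤ p →
          Integrable (fun ω => |⟪u, X ω⟫| ^ p) P ∧
            (∫ ω, |⟪u, X ω⟫| ^ p ∂P) ^ (1 / p) ≤ Real.sqrt p * M) →
        ∀ γ : Pr d, ‖γ‖ ≤ R →
          ‖gradient (genLoss P X (fclip a b) lam) γ - gradient (genLoss P X hq lam) γ‖ ≤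
            C₂ * R ^ 3 * M ^ 4 * Real.exp (-C₁ * a ^ 2 / (R ^ 2 * M ^ 2)) ∧
          ‖fderiv ℝ (gradient (genLoss P X (fclip a b) lam)) γ
              - fderiv ℝ (gradient (genLoss P X hq lam)) γ‖ ≤
            C₂ * R ^ 2 * M ^ 4 * Real.exp (-C₁ * a ^ 2 / (R ^ 2 * M ^ 2)) := by
  refine ⟨1, 1 / 64, 184320, by norm_num, by norm_num, by norm_num, ?_⟩
  intro d Ω _ P _ X M lam a b R hM ha hab _ hR hXm hsub γ hγ
  have hX : AEStronglyMeasurable X P := hXm.aestronglyMeasurable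
  have hSG : auxSG P X M := hsub
  have hi := aux_int4 hX hSG
  have hreg := auxr_reg ha hab
  set ρ : Pr d → ℝ := fun γ => lam / 2 * ((WithLp.equiv 2 (ℝ × Vec d) γ).1) ^ 2 with hρ
  have hρc : ContDiff ℝ 2 ρ := by
    have h1 : ContDiff ℝ 2 (fun γ : Pr d => ((WithLp.equiv 2 (ℝ × Vec d) γ).1)) :=
      ((ContinuousLinearMap.fst ℝ ℝ (Vec d)).comp
        (WithLp.prodContinuousLinearEquiv 2 ℝ ℝ (Vec d)).toContinuousLinearMap).contDiff
    exact contDiff_const.mul (h1.pow 2)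
  have hρd : Differentiable ℝ ρ := hρc.differentiable (by norm_num)
  have hρg : Differentiable ℝ (gradient ρ) := by
    have h1 : Differentiable ℝ (fderiv ℝ ρ) :=
      (hρc.fderiv_right (m := 1) (by norm_num)).differentiable (by norm_num)
    exact ((InnerProductSpace.toDual ℝ (Pr d)).symm.toContinuousLinearEquiv.differentiable).comp h1
  have gh : ∀ γ, HasGradientAt (genLoss P X hq lam)
      ((∫ ω, ((fun x : ℝ => x ^ 3 - x) (inner ℝ γ (X ω))) • X ω ∂P) + gradient ρ γ) γ := by
    intro γ
    exact aux_addgrad (aux_grad auxh_reg hX hi γ) (hρd γ).hasGradientAt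
  have gf : ∀ γ, HasGradientAt (genLoss P X (fclip a b) lam)
      (((∫ ω, ((fun x : ℝ => x ^ 3 - x) (inner ℝ γ (X ω))) • X ω ∂P) + gradient ρ γ)
        + ∫ ω, auxr1 a b (inner ℝ γ (X ω)) • X ω ∂P) γ := by
    intro γ
    have e : genLoss P X (fclip a b) lam = fun γ => genLoss P X hq lam γ
        + ∫ ω, auxr a b (inner ℝ γ (X ω)) ∂P := by
      funext γ
      unfold genLoss
      simp_rw [fclip_eq ha hab]
      rw [integral_add (aux_int0 auxh_reg hX hi γ) (aux_int0 hreg hX hi γ)]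
      ring
    rw [e]
    exact aux_addgrad (gh γ) (aux_grad hreg hX hi γ)
  rw [gradient_eq gh, gradient_eq gf]
  constructor
  · rw [add_sub_cancel_left]
    exact aux_rgrad hM hR ha hab hX hSG γ hγ
  · have dh := (aux_hess auxh_reg hX hi γ).add (hρg γ).hasFDerivAt
    have df := dh.add (aux_hess hreg hX hi γ)
    have e1 := dh.fderiv
    have e2 := df.fderiv
    rw [show fderiv ℝ (fun γ => (∫ ω, ((fun x : ℝ => x ^ 3 - x) (inner ℝ γ (X ω))) • X ω ∂P)
      + gradient ρ γ) γ = _ from e1]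
    rw [show fderiv ℝ (fun γ => ((∫ ω, ((fun x : ℝ => x ^ 3 - x) (inner ℝ γ (X ω))) • X ω ∂P)
      + gradient ρ γ) + ∫ ω, auxr1 a b (inner ℝ γ (X ω)) • X ω ∂P) γ = _ from e2]
    rw [add_sub_cancel_left]
    exact aux_rhess hM hR ha hab hX hSG γ hγ
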